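/- On a Cahen-Wallach space (ℝ^{n+2}, g_cw) with κᵢ ≠ κⱼ for some i,j, every solution X of the Ricci soliton equation L_X g_cw + Ric = λ g_cw has components X_u = a, X_v = b + λ v + (Σᵢ κᵢ)(u/2) − Σᵢ xᵢ hᵢ'(u), X_j = (λ/2) x_j + h_j(u) + Σ_{i≠j} c_{ij} xᵢ, where a, b are constants, (c_{ij}) is a skew-symmetric constant matrix with c_{ij}(κᵢ − κⱼ) = 0, and each hᵢ solves κᵢ hᵢ − hᵢ'' = 0. -/

import Mathlib

noncomputable section

/-- A point of `ℝ^{n+2}`, written `(u, v, x)`. -/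
abbrev Pt (n : ℕ) : Type := ℝ × ℝ × (Fin n → ℝ)

/-- The `k`-th coordinate direction in `ℝ^{n+2}` (`k = 0` is `∂_u`, `k = 1` is `∂_v`,
`k = i + 2` is `∂_{x_i}`). -/
def cdir (n : ℕ) (k : Fin (n + 2)) : Pt n :=
  if (k : ℕ) = 0 then (1, 0, 0)
  else if (k : ℕ) = 1 then (0, 1, 0)
  else (0, 0, fun i => if (i : ℕ) + 2 = (k : ℕ) then 1 else 0)

/-- Partial derivative along the `k`-th coordinate direction. -/
def pd {n : ℕ} (k : Fin (n + 2)) (F : Pt n → ℝ) (p : Pt n) : ℝ :=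
  fderiv ℝ F p (cdir n k)

/-- The `x`-coordinate of `p` associated to an index `k` with `2 ≤ k`. -/
def xc {n : ℕ} (p : Pt n) (k : Fin (n + 2)) : ℝ :=
  if h : 2 ≤ (k : ℕ) then p.2.2 ⟨(k : ℕ) - 2, by have := k.isLt; omega⟩ else 0

/-- The value `κ_i` associated to an index `k = i + 2` with `2 ≤ k`. -/
def κc {n : ℕ} (κ : Fin n → ℝ) (k : Fin (n + 2)) : ℝ :=
  if h : 2 ≤ (k : ℕ) then κ ⟨(k : ℕ) - 2, by have := k.isLt; omega⟩ else 0

/-- The index of `ℝ^{n+2}` corresponding to the coordinate `x_i`. -/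
def xi (n : ℕ) (i : Fin n) : Fin (n + 2) := ⟨(i : ℕ) + 2, by have := i.isLt; omega⟩

/-- The Cahen-Wallach metric `g_cw = (Σᵢ κᵢ xᵢ²)(du)² + du dv + Σᵢ (dxᵢ)²` on `ℝ^{n+2}`. -/
def gCW {n : ℕ} (κ : Fin n → ℝ) (p : Pt n) (k l : Fin (n + 2)) : ℝ :=
  if (k : ℕ) = 0 ∧ (l : ℕ) = 0 then ∑ a, κ a * (p.2.2 a) ^ 2
  else if ((k : ℕ) = 0 ∧ (l : ℕ) = 1) ∨ ((k : ℕ) = 1 ∧ (l : ℕ) = 0) then 1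
  else if k = l ∧ 2 ≤ (k : ℕ) then 1 else 0

/-- The inverse of the Cahen-Wallach metric. -/
def gCWinv {n : ℕ} (κ : Fin n → ℝ) (p : Pt n) (k l : Fin (n + 2)) : ℝ :=
  if (k : ℕ) = 1 ∧ (l : ℕ) = 1 then -(∑ a, κ a * (p.2.2 a) ^ 2)
  else if ((k : ℕ) = 0 ∧ (l : ℕ) = 1) ∨ ((k : ℕ) = 1 ∧ (l : ℕ) = 0) then 1
  else if k = l ∧ 2 ≤ (k : ℕ) then 1 else 0

/-- Christoffel symbols `Γ^k_{ij}` of the Levi-Civita connection of `g_cw`. -/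
def ΓCW {n : ℕ} (κ : Fin n → ℝ) (p : Pt n) (k i j : Fin (n + 2)) : ℝ :=
  (1 / 2) * ∑ l, gCWinv κ p k l *
    (pd i (fun q => gCW κ q l j) p + pd j (fun q => gCW κ q l i) p
      - pd l (fun q => gCW κ q i j) p)

/-- Component `l` of `R(∂_i, ∂_j) ∂_k`, where `R(X,Y) = ∇_{[X,Y]} - [∇_X, ∇_Y]`. -/
def RCW {n : ℕ} (κ : Fin n → ℝ) (p : Pt n) (l i j k : Fin (n + 2)) : ℝ :=
  -(pd i (fun q => ΓCW κ q l j k) p - pd j (fun q => ΓCW κ q l i k) p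
    + ∑ m, (ΓCW κ p l i m * ΓCW κ p m j k - ΓCW κ p l j m * ΓCW κ p m i k))

/-- The `(0,4)`-curvature tensor `R(∂_i, ∂_j, ∂_k, ∂_l) = g(R(∂_i, ∂_j) ∂_k, ∂_l)`. -/
def R4CW {n : ℕ} (κ : Fin n → ℝ) (p : Pt n) (i j k l : Fin (n + 2)) : ℝ :=
  ∑ m, RCW κ p m i j k * gCW κ p m l

/-- Ricci tensor of `g_cw`: `Ric(X,Y) = trace (Z ↦ R(X,Z)Y)`. -/
def RicCW {n : ℕ} (κ : Fin n → ℝ) (p : Pt n) (i j : Fin (n + 2)) : ℝ :=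
  ∑ k, RCW κ p k i k j

/-- Lie derivative of `g_cw` along a vector field with components `X`. -/
def lieCW {n : ℕ} (κ : Fin n → ℝ) (X : Pt n → Fin (n + 2) → ℝ) (p : Pt n)
    (i j : Fin (n + 2)) : ℝ :=
  ∑ k, (X p k * pd k (fun q => gCW κ q i j) p
    + gCW κ p k j * pd i (fun q => X q k) p
    + gCW κ p i k * pd j (fun q => X q k) p)

/-- Hessian `Hess_h(∂_i, ∂_j)` with respect to the Levi-Civita connection of `g_cw`. -/
def hessCW {n : ℕ} (κ : Fin n → ℝ) (h : Pt n → ℝ) (p : Pt n) (i j : Fin (n + 2)) : ℝ :=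
  pd i (fun q => pd j h q) p - ∑ k, ΓCW κ p k i j * pd k h p

/-- Components of the gradient of `h` with respect to `g_cw`. -/
def gradCW {n : ℕ} (κ : Fin n → ℝ) (h : Pt n → ℝ) (p : Pt n) (k : Fin (n + 2)) : ℝ :=
  ∑ l, gCWinv κ p k l * pd l h p

/-- Component `k` of the covariant derivative `∇_{∂_i} X` for `g_cw`. -/
def covCW {n : ℕ} (κ : Fin n → ℝ) (X : Pt n → Fin (n + 2) → ℝ) (p : Pt n)
    (i k : Fin (n + 2)) : ℝ :=
  pd i (fun q => X q k) p + ∑ j, ΓCW κ p k i j * X p j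

/-- The Ricci operator of `g_cw`, `g(QX, Y) = Ric(X, Y)`. -/
def QCW {n : ℕ} (κ : Fin n → ℝ) (p : Pt n) (k i : Fin (n + 2)) : ℝ :=
  ∑ j, gCWinv κ p k j * RicCW κ p j i


section PartialDerivatives

variable {n : ℕ}

theorem sum_index (f : Fin (n + 2) → ℝ) :
    ∑ k, f k = f 0 + (f 1 + ∑ a, f (xi n a)) := by
  rw [Fin.sum_univ_succ, Fin.sum_univ_succ]
  rfl

theorem index_cases {P : Fin (n + 2) → Prop} (h0 : P 0) (h1 : P 1) (hx : ∀ a, P (xi n a))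
    (k : Fin (n + 2)) : P k := by
  refine Fin.cases h0 (fun k => ?_) k
  exact Fin.cases h1 hx k

@[simp] theorem val_xi (a : Fin n) : (xi n a : ℕ) = a + 2 := rfl

@[simp] theorem xi_inj {a b : Fin n} : xi n a = xi n b ↔ a = b := by
  simp [Fin.ext_iff]

@[simp] theorem xi_ne_zero (a : Fin n) : xi n a ≠ 0 := by
  intro h
  simpa using congrArg Fin.val h

@[simp] theorem xi_ne_one (a : Fin n) : xi n a ≠ 1 := by
  intro h
  simpa using congrArg Fin.val h

@[simp] theorem zero_ne_xi (a : Fin n) : 0 ≠ xi n a := (xi_ne_zero a).symm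

@[simp] theorem one_ne_xi (a : Fin n) : 1 ≠ xi n a := (xi_ne_one a).symm

@[simp] theorem cdir_zero : cdir n 0 = (1, 0, 0) := by simp [cdir]

@[simp] theorem cdir_one : cdir n 1 = (0, 1, 0) := by simp [cdir]

@[simp] theorem cdir_xi (a : Fin n) : cdir n (xi n a) = (0, 0, Pi.single a 1) := by
  simp only [cdir, val_xi]
  simp only [Nat.add_eq_zero_iff, OfNat.ofNat_ne_zero, and_false, if_false,
    Nat.reduceEqDiff, Prod.mk.injEq, true_and]
  ext i
  simp [Pi.single_apply, Fin.ext_iff]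

theorem contDiff_pd {F : Pt n → ℝ} (hF : ContDiff ℝ (⊤ : ℕ∞) F) (k : Fin (n + 2)) :
    ContDiff ℝ (⊤ : ℕ∞) (pd k F) :=
  (hF.fderiv_right (m := (⊤ : ℕ∞)) (by simp)).clm_apply contDiff_const

theorem ContDiff.differentiable_pt {F : Pt n → ℝ} (hF : ContDiff ℝ (⊤ : ℕ∞) F) :
    Differentiable ℝ F :=
  hF.differentiable (by simp)

theorem pd_comm {F : Pt n → ℝ} (hF : ContDiff ℝ (⊤ : ℕ∞) F) (i j : Fin (n + 2)) (p : Pt n) :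
    pd i (pd j F) p = pd j (pd i F) p := by
  have hd : Differentiable ℝ (fderiv ℝ F) :=
    (hF.fderiv_right (m := (⊤ : ℕ∞)) (by simp)).differentiable (by simp)
  have key : ∀ i j, pd i (pd j F) p = fderiv ℝ (fderiv ℝ F) p (cdir n i) (cdir n j) := by
    intro i j
    have := (hd p).hasFDerivAt.clm_apply (hasFDerivAt_const (cdir n j) p)
    change fderiv ℝ (fun q => fderiv ℝ F q (cdir n j)) p (cdir n i) = _
    rw [this.fderiv]
    simp
  rw [key, key]
  exact (hF.contDiffAt.isSymmSndFDerivAt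
    (by simpa using WithTop.coe_le_coe.2 (le_top : (2 : ℕ∞) ≤ ⊤))).eq _ _

@[simp] theorem pd_const (k : Fin (n + 2)) (c : ℝ) (p : Pt n) : pd k (fun _ => c) p = 0 := by
  simp [pd]

theorem pd_neg (k : Fin (n + 2)) (F : Pt n → ℝ) (p : Pt n) :
    pd k (fun q => -F q) p = -pd k F p := by
  simp [pd, fderiv_fun_neg]

theorem pd_add (k : Fin (n + 2)) {F G : Pt n → ℝ} (hF : Differentiable ℝ F)
    (hG : Differentiable ℝ G) (p : Pt n) :
    pd k (fun q => F q + G q) p = pd k F p + pd k G p := by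
  simp [pd, fderiv_fun_add (hF p) (hG p)]

theorem pd_sub (k : Fin (n + 2)) {F G : Pt n → ℝ} (hF : Differentiable ℝ F)
    (hG : Differentiable ℝ G) (p : Pt n) :
    pd k (fun q => F q - G q) p = pd k F p - pd k G p := by
  simp [pd, fderiv_fun_sub (hF p) (hG p)]

theorem pd_mul (k : Fin (n + 2)) {F G : Pt n → ℝ} (hF : Differentiable ℝ F)
    (hG : Differentiable ℝ G) (p : Pt n) :
    pd k (fun q => F q * G q) p = F p * pd k G p + pd k F p * G p := by
  simp [pd, fderiv_fun_mul (hF p) (hG p), mul_comm]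

theorem pd_const_mul (k : Fin (n + 2)) (c : ℝ) {F : Pt n → ℝ} (hF : Differentiable ℝ F)
    (p : Pt n) : pd k (fun q => c * F q) p = c * pd k F p := by
  simp [pd, fderiv_const_mul (hF p)]

theorem pd_sum (k : Fin (n + 2)) {ι : Type*} (s : Finset ι) {F : ι → Pt n → ℝ}
    (hF : ∀ i, Differentiable ℝ (F i)) (p : Pt n) :
    pd k (fun q => ∑ i ∈ s, F i q) p = ∑ i ∈ s, pd k (F i) p := by
  simp [pd, fderiv_fun_sum (fun i _ => hF i p)]

theorem pd_clm (k : Fin (n + 2)) (L : Pt n →L[ℝ] ℝ) (p : Pt n) :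
    pd k (fun q => L q) p = L (cdir n k) := by
  simp [pd]

theorem pd_coord_v (k : Fin (n + 2)) (p : Pt n) :
    pd k (fun q => q.2.1) p = (cdir n k).2.1 :=
  pd_clm k ((ContinuousLinearMap.fst ℝ ℝ (Fin n → ℝ)).comp
    (ContinuousLinearMap.snd ℝ ℝ (ℝ × (Fin n → ℝ)))) p

theorem pd_coord_x (k : Fin (n + 2)) (i : Fin n) (p : Pt n) :
    pd k (fun q => q.2.2 i) p = (cdir n k).2.2 i :=
  pd_clm k ((ContinuousLinearMap.proj i).comp ((ContinuousLinearMap.snd ℝ ℝ (Fin n → ℝ)).comp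
    (ContinuousLinearMap.snd ℝ ℝ (ℝ × (Fin n → ℝ))))) p

theorem hasDerivAt_axis {F : Pt n → ℝ} (hF : Differentiable ℝ F) (u : ℝ) :
    HasDerivAt (fun u => F (u, 0, 0)) (pd 0 F (u, 0, 0)) u := by
  have h1 : HasDerivAt (fun u : ℝ => ((u, 0, 0) : Pt n)) (1, 0, 0) u :=
    (hasDerivAt_id u).prodMk (hasDerivAt_const u (0, 0))
  have := (hF (u, 0, 0)).hasFDerivAt.comp_hasDerivAt u h1
  rwa [pd, cdir_zero]

/-- A function whose `v`- and `x`-derivatives vanish depends on `u` only. -/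
theorem eq_axis {F : Pt n → ℝ} (hF : Differentiable ℝ F) (h1 : ∀ p, pd 1 F p = 0)
    (hx : ∀ a p, pd (xi n a) F p = 0) (p : Pt n) : F p = F (p.1, 0, 0) := by
  have hdir : ((0, p.2.1, p.2.2) : Pt n)
      = p.2.1 • cdir n 1 + ∑ a, p.2.2 a • cdir n (xi n a) := by
    ext i
    · simp [Prod.fst_sum]
    · simp [Prod.fst_sum, Prod.snd_sum]
    · simp [Prod.snd_sum, Pi.single_apply]
  have hd : ∀ t : ℝ, HasDerivAt (fun t : ℝ => F (p.1, t * p.2.1, t • p.2.2)) 0 t := by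
    intro t
    have hl : HasDerivAt (fun t : ℝ => ((p.1, t * p.2.1, t • p.2.2) : Pt n))
        (0, p.2.1, p.2.2) t := by
      have hv := (hasDerivAt_id t).mul_const p.2.1
      have hw := (hasDerivAt_id t).smul_const p.2.2
      simpa using (hasDerivAt_const t p.1).prodMk (hv.prodMk hw)
    have := (hF (p.1, t * p.2.1, t • p.2.2)).hasFDerivAt.comp_hasDerivAt t hl
    have h0 : fderiv ℝ F (p.1, t * p.2.1, t • p.2.2) (0, p.2.1, p.2.2) = 0 := by
      simp only [pd] at h1 hx
      rw [hdir, map_add, map_smul, map_sum]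
      simp only [map_smul, h1, hx, smul_zero, Finset.sum_const_zero, add_zero]
    rwa [h0] at this
  have := is_const_of_deriv_eq_zero (fun t => (hd t).differentiableAt)
    (fun t => (hd t).deriv) 1 0
  simpa using this

theorem eq_const {F : Pt n → ℝ} (hF : Differentiable ℝ F) (h : ∀ k p, pd k F p = 0)
    (p : Pt n) : F p = F 0 := by
  rw [eq_axis hF (h 1) (fun a => h (xi n a)) p]
  have hd := hasDerivAt_axis hF
  exact is_const_of_deriv_eq_zero (fun t => (hd t).differentiableAt)
    (fun t => (hd t).deriv.trans (h 0 _)) p.1 0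

end PartialDerivatives

section Geometry

variable {n : ℕ} (κ : Fin n → ℝ)

theorem pd_profile (k : Fin (n + 2)) (p : Pt n) :
    pd k (fun q => ∑ a, κ a * q.2.2 a ^ 2) p
      = ∑ a, 2 * κ a * p.2.2 a * (cdir n k).2.2 a := by
  simp only [pow_two]
  rw [pd_sum k _ (fun i => by fun_prop)]
  refine Finset.sum_congr rfl fun a _ => ?_
  rw [pd_const_mul k _ (by fun_prop), pd_mul k (by fun_prop) (by fun_prop), pd_coord_x]
  ring

theorem pd_gCW (k i j : Fin (n + 2)) (p : Pt n) :
    pd k (fun q => gCW κ q i j) p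
      = if i = 0 ∧ j = 0 then ∑ a, 2 * κ a * p.2.2 a * (cdir n k).2.2 a else 0 := by
  by_cases h : i = 0 ∧ j = 0
  · obtain ⟨rfl, rfl⟩ := h
    simpa [gCW] using pd_profile κ k p
  · have h' : ¬((i : ℕ) = 0 ∧ (j : ℕ) = 0) := by rwa [Fin.ext_iff, Fin.ext_iff] at h
    simp only [gCW, h, h', if_false, pd_const]

theorem ΓCW_zero (p : Pt n) (i j : Fin (n + 2)) : ΓCW κ p 0 i j = 0 := by
  simp [ΓCW, sum_index, gCWinv, pd_gCW]

theorem ΓCW_one (p : Pt n) (i j : Fin (n + 2)) :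
    ΓCW κ p 1 i j = (if j = 0 then ∑ a, κ a * p.2.2 a * (cdir n i).2.2 a else 0)
      + if i = 0 then ∑ a, κ a * p.2.2 a * (cdir n j).2.2 a else 0 := by
  have h2 : ∀ k, ∑ a, 2 * κ a * p.2.2 a * (cdir n k).2.2 a
      = 2 * ∑ a, κ a * p.2.2 a * (cdir n k).2.2 a := fun k => by
    rw [Finset.mul_sum]; exact Finset.sum_congr rfl fun a _ => by ring
  simp only [ΓCW, sum_index, pd_gCW, h2]
  simp [gCWinv]
  split_ifs <;> ring

theorem ΓCW_xi (p : Pt n) (b : Fin n) (i j : Fin (n + 2)) :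
    ΓCW κ p (xi n b) i j = if i = 0 ∧ j = 0 then -(κ b * p.2.2 b) else 0 := by
  simp only [ΓCW, sum_index, pd_gCW]
  simp [gCWinv, Pi.single_apply]
  split_ifs <;> ring

theorem RicCW_eq (p : Pt n) (i j : Fin (n + 2)) :
    RicCW κ p i j = if i = 0 ∧ j = 0 then -∑ a, κ a else 0 := by
  have hx : ∀ a, pd (xi n a) (fun q => ΓCW κ q (xi n a) i j) p
      = if i = 0 ∧ j = 0 then -κ a else 0 := by
    intro a
    simp only [ΓCW_xi]
    split_ifs
    · rw [pd_neg, pd_const_mul _ _ (by fun_prop), pd_coord_x]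
      simp
    · simp
  have h1 : pd 1 (fun q => ΓCW κ q 1 i j) p = 0 := by
    have hs : ∀ k, pd 1 (fun q : Pt n => ∑ a, κ a * q.2.2 a * (cdir n k).2.2 a) p = 0 := by
      intro k
      rw [pd_sum _ _ (fun i => by fun_prop)]
      refine Finset.sum_eq_zero fun a _ => ?_
      rw [pd_mul _ (by fun_prop) (by fun_prop), pd_const_mul _ _ (by fun_prop), pd_coord_x]
      simp
    simp only [ΓCW_one]
    rw [pd_add _ (by split_ifs <;> fun_prop) (by split_ifs <;> fun_prop)]
    split_ifs <;> simp [hs]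
  have ht : ∀ q k j, ΓCW κ q k k j = 0 := by
    intro q k j
    induction k using index_cases with
    | h0 => exact ΓCW_zero κ q _ _
    | h1 => simp [ΓCW_one]
    | hx a => simp [ΓCW_xi]
  have hq : ∀ k m, ΓCW κ p k i m * ΓCW κ p m k j = 0 := by
    intro k m
    induction k using index_cases with
    | h0 => simp [ΓCW_zero]
    | h1 =>
      induction m using index_cases with
      | h0 => simp [ΓCW_zero]
      | h1 => simp [ΓCW_one]
      | hx a => simp [ΓCW_xi]
    | hx a =>
      induction m using index_cases with
      | h0 => simp [ΓCW_zero]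
      | h1 => simp [ΓCW_xi]
      | hx a => simp [ΓCW_xi]
  simp only [RicCW, RCW, ht, hq, zero_mul, sub_zero, Finset.sum_const_zero, add_zero, pd_const,
    zero_sub, neg_neg]
  rw [sum_index, h1]
  simp only [ΓCW_zero, pd_const, hx]
  split_ifs <;> simp

end Geometry

section Soliton

variable {n : ℕ} {κ : Fin n → ℝ} {lam : ℝ}

/-- The soliton equation for `g_cw`, written out for the components `U ∂_u + V ∂_v + Σᵢ Wᵢ ∂_{x_i}`
of the vector field. -/
structure SolitonSystem (κ : Fin n → ℝ) (lam : ℝ) (U V : Pt n → ℝ) (W : Fin n → Pt n → ℝ) :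
    Prop where
  smooth_U : ContDiff ℝ (⊤ : ℕ∞) U
  smooth_V : ContDiff ℝ (⊤ : ℕ∞) V
  smooth_W : ∀ i, ContDiff ℝ (⊤ : ℕ∞) (W i)
  vv : ∀ p, pd 1 U p = 0
  uv : ∀ p, pd 1 V p = lam - pd 0 U p
  vx : ∀ i p, pd 1 (W i) p = -pd (xi n i) U p
  xx : ∀ i j p, pd (xi n i) (W j) p + pd (xi n j) (W i) p = if i = j then lam else 0
  ux : ∀ i p, pd (xi n i) V p
    = -pd 0 (W i) p - (∑ a, κ a * p.2.2 a ^ 2) * pd (xi n i) U p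
  uu : ∀ p, pd 0 V p = (∑ a, κ a) / 2 + lam / 2 * (∑ a, κ a * p.2.2 a ^ 2)
    - (∑ a, κ a * p.2.2 a ^ 2) * pd 0 U p - ∑ a, κ a * p.2.2 a * W a p

theorem lieCW_eq (κ : Fin n → ℝ) (X : Pt n → Fin (n + 2) → ℝ) (p : Pt n) (i j : Fin (n + 2)) :
    lieCW κ X p i j
      = (if i = 0 ∧ j = 0 then ∑ a, 2 * κ a * p.2.2 a * X p (xi n a) else 0)
        + ∑ k, gCW κ p k j * pd i (fun q => X q k) p
        + ∑ k, gCW κ p i k * pd j (fun q => X q k) p := by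
  have h : ∑ k, X p k * pd k (fun q => gCW κ q i j) p
      = if i = 0 ∧ j = 0 then ∑ a, 2 * κ a * p.2.2 a * X p (xi n a) else 0 := by
    simp only [sum_index, pd_gCW]
    split_ifs
    · simp [Pi.single_apply, mul_comm]
    · simp
  simp only [lieCW, Finset.sum_add_distrib, h]

theorem solitonSystem_of_lieCW {X : Pt n → Fin (n + 2) → ℝ}
    (hX : ∀ k, ContDiff ℝ (⊤ : ℕ∞) (fun p => X p k))
    (hsol : ∀ (p : Pt n) (i j : Fin (n + 2)),
      lieCW κ X p i j + RicCW κ p i j = lam * gCW κ p i j) :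
    SolitonSystem κ lam (fun p => X p 0) (fun p => X p 1) (fun i p => X p (xi n i)) := by
  simp only [lieCW_eq, RicCW_eq, sum_index] at hsol
  have hvv : ∀ p, pd 1 (fun q => X q 0) p = 0 := fun p => by
    have := hsol p 1 1
    simp [gCW] at this
    linarith
  refine ⟨hX 0, hX 1, fun i => hX _, hvv, fun p => ?_, fun i p => ?_, fun i j p => ?_,
    fun i p => ?_, fun p => ?_⟩
  · have := hsol p 0 1
    simp [gCW, hvv] at this
    linarith
  · have := hsol p 1 (xi n i)
    simp [gCW] at this
    linarith
  · have := hsol p (xi n i) (xi n j)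
    simp [gCW] at this
    linarith
  · have := hsol p 0 (xi n i)
    simp [gCW] at this
    linarith
  · have := hsol p 0 0
    have h2 : ∑ a, 2 * κ a * p.2.2 a * X p (xi n a)
        = 2 * ∑ a, κ a * p.2.2 a * X p (xi n a) := by
      rw [Finset.mul_sum]; exact Finset.sum_congr rfl fun a _ => by ring
    rw [h2] at this
    simp [gCW] at this
    linarith

namespace SolitonSystem

variable {U V : Pt n → ℝ} {W : Fin n → Pt n → ℝ}

theorem pd_v_pd_W (h : SolitonSystem κ lam U V W) (k : Fin (n + 2)) (i : Fin n) (p : Pt n) :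
    pd 1 (pd k (W i)) p = -pd k (pd (xi n i) U) p := by
  rw [pd_comm (h.smooth_W i), funext (h.vx i), pd_neg]

theorem pd_v_pd_V (h : SolitonSystem κ lam U V W) (k : Fin (n + 2)) (p : Pt n) :
    pd 1 (pd k V) p = -pd k (pd 0 U) p := by
  rw [pd_comm h.smooth_V, funext h.uv,
    pd_sub k (by fun_prop) (contDiff_pd h.smooth_U 0).differentiable_pt, pd_const, zero_sub]

theorem pd_v_pd_U (h : SolitonSystem κ lam U V W) (k : Fin (n + 2)) (p : Pt n) :
    pd 1 (pd k U) p = 0 := by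
  rw [pd_comm h.smooth_U, funext h.vv, pd_const]

theorem pd_x_pd_x_U (h : SolitonSystem κ lam U V W) (i j : Fin n) (p : Pt n) :
    pd (xi n i) (pd (xi n j) U) p = 0 := by
  have h1 := congrArg (fun F => pd 1 F p) (funext (h.xx i j))
  rw [pd_add 1 (contDiff_pd (h.smooth_W j) _).differentiable_pt
    (contDiff_pd (h.smooth_W i) _).differentiable_pt, pd_const, h.pd_v_pd_W, h.pd_v_pd_W,
    pd_comm h.smooth_U (xi n j)] at h1
  linarith

theorem pd_v_profile (κ : Fin n → ℝ) (p : Pt n) :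
    pd 1 (fun q => ∑ a, κ a * q.2.2 a ^ 2) p = 0 := by
  simp [pd_profile]

theorem pd_u_pd_x_U (h : SolitonSystem κ lam U V W) (i : Fin n) (p : Pt n) :
    pd 0 (pd (xi n i) U) p = 0 := by
  have h1 := congrArg (fun F => pd 1 F p) (funext (h.ux i))
  have dU := (contDiff_pd h.smooth_U (xi n i)).differentiable_pt
  have dW := (contDiff_pd (h.smooth_W i) 0).differentiable_pt
  rw [pd_sub 1 (by fun_prop) (by fun_prop), pd_neg, pd_mul 1 (by fun_prop) dU,
    pd_v_profile, h.pd_v_pd_U, h.pd_v_pd_V, h.pd_v_pd_W, pd_comm h.smooth_U (xi n i)] at h1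
  linarith

theorem pd_x_U_eq_const (h : SolitonSystem κ lam U V W) (i : Fin n) (p : Pt n) :
    pd (xi n i) U p = pd (xi n i) U 0 := by
  refine eq_const (contDiff_pd h.smooth_U _).differentiable_pt (fun k q => ?_) p
  induction k using index_cases with
  | h0 => exact h.pd_u_pd_x_U i q
  | h1 => exact h.pd_v_pd_U _ q
  | hx a => exact h.pd_x_pd_x_U a i q

theorem pd_u_pd_u_U (h : SolitonSystem κ lam U V W) (p : Pt n) :
    pd 0 (pd 0 U) p = -∑ a, κ a * p.2.2 a * pd (xi n a) U p := by
  have h1 := congrArg (fun F => pd 1 F p) (funext h.uu)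
  have dU := (contDiff_pd h.smooth_U 0).differentiable_pt
  have dW := fun i => (h.smooth_W i).differentiable_pt
  rw [pd_sub 1 (by fun_prop) (by fun_prop), pd_sub 1 (by fun_prop) (by fun_prop),
    pd_add 1 (by fun_prop) (by fun_prop), pd_mul 1 (by fun_prop) dU,
    pd_const_mul 1 _ (by fun_prop), pd_const, pd_v_profile, h.pd_v_pd_U, h.pd_v_pd_V,
    pd_sum 1 _ (fun i => by fun_prop)] at h1
  have h2 : ∀ a, pd 1 (fun q => κ a * q.2.2 a * W a q) p
      = -(κ a * p.2.2 a * pd (xi n a) U p) := by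
    intro a
    rw [pd_mul 1 (by fun_prop) (dW a), pd_const_mul 1 _ (by fun_prop), pd_coord_x, h.vx]
    simp
  simp only [h2, Finset.sum_neg_distrib] at h1
  linarith

theorem pd_u_pd_u_U_eq_zero (h : SolitonSystem κ lam U V W) (p : Pt n) :
    pd 0 (pd 0 U) p = 0 := by
  have hc := contDiff_pd h.smooth_U 0
  rw [eq_axis (contDiff_pd hc 0).differentiable_pt (fun q => ?_) (fun a q => ?_) p,
    h.pd_u_pd_u_U]
  · simp
  · rw [pd_comm hc, funext (h.pd_v_pd_U 0), pd_const]
  · have : pd (xi n a) (pd 0 U) = fun _ => 0 := funext fun q => by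
      rw [pd_comm h.smooth_U, h.pd_u_pd_x_U]
    rw [pd_comm hc, this, pd_const]

theorem pd_x_U (h : SolitonSystem κ lam U V W) (hκ : ∀ i, κ i ≠ 0) (i : Fin n) (p : Pt n) :
    pd (xi n i) U p = 0 := by
  have h1 := h.pd_u_pd_u_U (0, 0, Pi.single i 1)
  rw [h.pd_u_pd_u_U_eq_zero] at h1
  simp only [h.pd_x_U_eq_const _ (0, 0, Pi.single i 1)] at h1
  rw [h.pd_x_U_eq_const]
  simpa [Pi.single_apply, hκ i] using h1

theorem pd_u_U_eq_const (h : SolitonSystem κ lam U V W) (p : Pt n) :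
    pd 0 U p = pd 0 U 0 := by
  refine eq_const (contDiff_pd h.smooth_U _).differentiable_pt (fun k q => ?_) p
  induction k using index_cases with
  | h0 => exact h.pd_u_pd_u_U_eq_zero q
  | h1 => exact h.pd_v_pd_U _ q
  | hx a => rw [pd_comm h.smooth_U, h.pd_u_pd_x_U]

theorem pd_v_W (h : SolitonSystem κ lam U V W) (hκ : ∀ i, κ i ≠ 0) (i : Fin n) (p : Pt n) :
    pd 1 (W i) p = 0 := by
  rw [h.vx, h.pd_x_U hκ, neg_zero]

theorem pd_x_V (h : SolitonSystem κ lam U V W) (hκ : ∀ i, κ i ≠ 0) (i : Fin n) (p : Pt n) :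
    pd (xi n i) V p = -pd 0 (W i) p := by
  rw [h.ux, h.pd_x_U hκ, mul_zero, sub_zero]

theorem pd_pd_W_antisymm (h : SolitonSystem κ lam U V W) (k : Fin (n + 2)) (i j : Fin n)
    (p : Pt n) : pd k (pd (xi n i) (W j)) p = -pd k (pd (xi n j) (W i)) p := by
  have h1 := congrArg (fun F => pd k F p) (funext (h.xx i j))
  rw [pd_add k (contDiff_pd (h.smooth_W j) _).differentiable_pt
    (contDiff_pd (h.smooth_W i) _).differentiable_pt, pd_const] at h1
  linarith

theorem pd_x_W_eq_const (h : SolitonSystem κ lam U V W) (hκ : ∀ i, κ i ≠ 0) (i j : Fin n)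
    (p : Pt n) : pd (xi n i) (W j) p = pd (xi n i) (W j) 0 := by
  refine eq_const (contDiff_pd (h.smooth_W j) _).differentiable_pt (fun k q => ?_) p
  induction k using index_cases with
  | h0 =>
    have hV : ∀ i j, pd 0 (pd (xi n i) (W j)) q = -pd (xi n i) (pd (xi n j) V) q := by
      intro i j
      rw [pd_comm (h.smooth_W j), funext (h.pd_x_V hκ j), pd_neg, neg_neg]
    have h1 := h.pd_pd_W_antisymm 0 i j q
    rw [hV, hV, pd_comm h.smooth_V (xi n j)] at h1
    rw [hV]
    linarith
  | h1 => rw [pd_comm (h.smooth_W j), funext (h.pd_v_W hκ j), pd_const]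
  | hx a =>
    have h1 := h.pd_pd_W_antisymm (xi n a) i j q
    have h2 := h.pd_pd_W_antisymm (xi n j) a i q
    have h3 := h.pd_pd_W_antisymm (xi n i) j a q
    rw [pd_comm (h.smooth_W i)] at h1
    rw [pd_comm (h.smooth_W a)] at h2
    rw [pd_comm (h.smooth_W j)] at h3
    linarith

theorem pd_x_W_self (h : SolitonSystem κ lam U V W) (i : Fin n) (p : Pt n) :
    pd (xi n i) (W i) p = lam / 2 := by
  have := h.xx i i p
  rw [if_pos rfl] at this
  linarith

theorem hasDerivAt_W (h : SolitonSystem κ lam U V W) (i : Fin n) (u : ℝ) :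
    HasDerivAt (fun u => W i (u, 0, 0)) (pd 0 (W i) (u, 0, 0)) u :=
  hasDerivAt_axis (h.smooth_W i).differentiable_pt u

theorem W_eq (h : SolitonSystem κ lam U V W) (hκ : ∀ i, κ i ≠ 0) (j : Fin n) (p : Pt n) :
    W j p = W j (p.1, 0, 0) + ∑ i, pd (xi n i) (W j) 0 * p.2.2 i := by
  have dW := (h.smooth_W j).differentiable_pt
  have hk : ∀ k q, pd k (fun q => W j q - ∑ i, pd (xi n i) (W j) 0 * q.2.2 i) q
      = pd k (W j) q - ∑ i, pd (xi n i) (W j) 0 * (cdir n k).2.2 i := by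
    intro k q
    rw [pd_sub k dW (by fun_prop), pd_sum k _ (fun i => by fun_prop)]
    congr 1
    refine Finset.sum_congr rfl fun i _ => ?_
    rw [pd_const_mul k _ (by fun_prop), pd_coord_x]
  have key := eq_axis (F := fun q => W j q - ∑ i, pd (xi n i) (W j) 0 * q.2.2 i)
    (by fun_prop) (fun q => by simp [hk, h.pd_v_W hκ])
    (fun a q => by rw [hk, h.pd_x_W_eq_const hκ]; simp [Pi.single_apply]) p
  simp only [Pi.zero_apply, mul_zero, Finset.sum_const_zero, sub_zero] at key
  linarith

theorem pd_sum_coord_mul (k : Fin (n + 2)) {G : Fin n → Pt n → ℝ}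
    (hG : ∀ i, Differentiable ℝ (G i)) (p : Pt n) :
    pd k (fun q => ∑ i, q.2.2 i * G i q) p
      = ∑ i, p.2.2 i * pd k (G i) p + ∑ i, (cdir n k).2.2 i * G i p := by
  rw [pd_sum k _ (fun i => by fun_prop), ← Finset.sum_add_distrib]
  refine Finset.sum_congr rfl fun i _ => ?_
  rw [pd_mul k (by fun_prop) (hG i), pd_coord_x]

theorem pd_pd_u_W (h : SolitonSystem κ lam U V W) (k : Fin (n + 2)) {i : Fin n} {c : ℝ}
    (hk : ∀ q, pd k (W i) q = c) (p : Pt n) : pd k (pd 0 (W i)) p = 0 := by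
  rw [pd_comm (h.smooth_W i), funext hk, pd_const]

theorem pd_pd_u_pd_u_W (h : SolitonSystem κ lam U V W) (k : Fin (n + 2)) {i : Fin n} {c : ℝ}
    (hk : ∀ q, pd k (W i) q = c) (p : Pt n) : pd k (pd 0 (pd 0 (W i))) p = 0 := by
  rw [pd_comm (contDiff_pd (h.smooth_W i) 0), funext (h.pd_pd_u_W k hk), pd_const]

theorem pd_u_V_axis (h : SolitonSystem κ lam U V W) (u : ℝ) :
    pd 0 V (u, 0, 0) = (∑ a, κ a) / 2 := by
  simp [h.uu]

theorem pd_u_V_eq (h : SolitonSystem κ lam U V W) (hκ : ∀ i, κ i ≠ 0) (p : Pt n) :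
    pd 0 V p = (∑ a, κ a) / 2 - ∑ i, p.2.2 i * pd 0 (pd 0 (W i)) (p.1, 0, 0) := by
  have dW := fun i => (contDiff_pd (contDiff_pd (h.smooth_W i) 0) 0).differentiable_pt
  have dV := (contDiff_pd h.smooth_V 0).differentiable_pt
  have h1 := fun i q => h.pd_pd_u_pd_u_W 1 (h.pd_v_W hκ i) q
  have hx := fun a i q => h.pd_pd_u_pd_u_W (xi n a) (h.pd_x_W_eq_const hκ a i) q
  have key := eq_axis (F := fun q => pd 0 V q + ∑ i, q.2.2 i * pd 0 (pd 0 (W i)) q)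
    (by fun_prop)
    (fun q => by
      rw [pd_add 1 dV (by fun_prop), pd_sum_coord_mul 1 dW, h.pd_v_pd_V, h.pd_u_pd_u_U_eq_zero]
      simp [h1])
    (fun a q => by
      rw [pd_add _ dV (by fun_prop), pd_sum_coord_mul _ dW, pd_comm h.smooth_V,
        funext (h.pd_x_V hκ a), pd_neg]
      simp [hx, Pi.single_apply]) p
  simp only [Pi.zero_apply, zero_mul, Finset.sum_const_zero, add_zero, h.pd_u_V_axis] at key
  simp only [← fun i => eq_axis (dW i) (h1 i) (fun a => hx a i) p]
  linarith

theorem V_eq (h : SolitonSystem κ lam U V W) (hκ : ∀ i, κ i ≠ 0) (hU : ∀ p, pd 0 U p = 0)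
    (p : Pt n) : V p = V 0 + lam * p.2.1 + (∑ i, κ i) * p.1 / 2
      - ∑ i, p.2.2 i * pd 0 (W i) (p.1, 0, 0) := by
  have dW := fun i => (contDiff_pd (h.smooth_W i) 0).differentiable_pt
  have dV := h.smooth_V.differentiable_pt
  have h1 := fun i q => h.pd_pd_u_W 1 (h.pd_v_W hκ i) q
  have hx := fun a i q => h.pd_pd_u_W (xi n a) (h.pd_x_W_eq_const hκ a i) q
  have key := eq_axis (F := fun q => V q - lam * q.2.1 + ∑ i, q.2.2 i * pd 0 (W i) q)
    (by fun_prop)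
    (fun q => by
      rw [pd_add 1 (by fun_prop) (by fun_prop), pd_sub 1 dV (by fun_prop),
        pd_const_mul 1 _ (by fun_prop), pd_coord_v, pd_sum_coord_mul 1 dW, h.uv, hU]
      simp [h1])
    (fun a q => by
      rw [pd_add _ (by fun_prop) (by fun_prop), pd_sub _ dV (by fun_prop),
        pd_const_mul _ _ (by fun_prop), pd_coord_v, pd_sum_coord_mul _ dW, h.pd_x_V hκ]
      simp [hx, Pi.single_apply]) p
  have haxis : V (p.1, 0, 0) - (∑ i, κ i) / 2 * p.1 = V 0 := by
    have hd : ∀ u, HasDerivAt (fun u => V (u, 0, 0) - (∑ i, κ i) / 2 * u) 0 u := by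
      intro u
      have := (hasDerivAt_axis dV u).sub ((hasDerivAt_id u).const_mul ((∑ i, κ i) / 2))
      rw [h.pd_u_V_axis, mul_one, sub_self] at this
      exact this
    have := is_const_of_deriv_eq_zero (fun u => (hd u).differentiableAt)
      (fun u => (hd u).deriv) p.1 0
    rw [mul_zero, sub_zero] at this
    exact this
  simp only [Pi.zero_apply, zero_mul, Finset.sum_const_zero, add_zero, mul_zero, sub_zero]
    at key
  simp only [← fun i => eq_axis (dW i) (h1 i) (fun a => hx a i) p]
  linarith

/-- The `uu`-equation as a polynomial identity in `x` at fixed `u`. -/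
theorem uu_polynomial (h : SolitonSystem κ lam U V W) (hκ : ∀ i, κ i ≠ 0) (u : ℝ)
    (x : Fin n → ℝ) :
    (lam / 2 - pd 0 U 0) * ∑ a, κ a * x a ^ 2
      - ∑ a, κ a * x a * (W a (u, 0, 0) + ∑ i, pd (xi n i) (W a) 0 * x i)
      = -∑ i, x i * pd 0 (pd 0 (W i)) (u, 0, 0) := by
  have h1 := h.uu (u, 0, x)
  have h2 := h.pd_u_V_eq hκ (u, 0, x)
  simp only [h.W_eq hκ _ (u, 0, x), h.pd_u_U_eq_const (u, 0, x)] at h1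
  simp only at h2
  linarith

theorem uu_single (h : SolitonSystem κ lam U V W) (hκ : ∀ i, κ i ≠ 0) (u : ℝ) (i : Fin n)
    (t : ℝ) :
    -pd 0 U 0 * κ i * t ^ 2 - κ i * t * W i (u, 0, 0)
      = -(t * pd 0 (pd 0 (W i)) (u, 0, 0)) := by
  have h1 := h.uu_polynomial hκ u (Pi.single i t)
  simp [Pi.single_apply, h.pd_x_W_self] at h1
  linarith

theorem pd_u_U (h : SolitonSystem κ lam U V W) (hκ : ∀ i, κ i ≠ 0) (i : Fin n) (p : Pt n) :
    pd 0 U p = 0 := by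
  have h1 := h.uu_single hκ 0 i 1
  have h2 := h.uu_single hκ 0 i (-1)
  have h3 : pd 0 U 0 * κ i = 0 := by linarith
  rw [h.pd_u_U_eq_const]
  exact (mul_eq_zero.1 h3).resolve_right (hκ i)

theorem pd_u_pd_u_W (h : SolitonSystem κ lam U V W) (hκ : ∀ i, κ i ≠ 0) (i : Fin n) (u : ℝ) :
    pd 0 (pd 0 (W i)) (u, 0, 0) = κ i * W i (u, 0, 0) := by
  have h1 := h.uu_single hκ u i 1
  have h2 := h.uu_single hκ u i (-1)
  linarith

theorem pd_x_W_mul_sub (h : SolitonSystem κ lam U V W) (hκ : ∀ i, κ i ≠ 0) {i j : Fin n}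
    (hij : i ≠ j) : pd (xi n i) (W j) 0 * (κ i - κ j) = 0 := by
  have hC := h.xx i j 0
  rw [if_neg hij] at hC
  set e : Fin n → ℝ := Pi.single i 1 + Pi.single j 1 with he
  have hs : ∀ f : Fin n → ℝ, ∑ a, f a * e a = f i + f j := fun f => by
    simp [he, Pi.single_apply, mul_add, Finset.sum_add_distrib]
  have hx : ∀ a, e a ^ 2 = e a := fun a => by
    by_cases hi : a = i
    · subst hi
      simp [he, hij]
    · by_cases hj : a = j <;> simp [he, hi, hj]
      simp [Ne.symm hij]
  have h1 := h.uu_polynomial hκ 0 e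
  simp only [hx, mul_right_comm (κ _) (e _), mul_comm (e _) (pd _ _ _)] at h1
  simp only [hs, h.pd_u_U hκ i 0, h.pd_x_W_self, h.pd_u_pd_u_W hκ] at h1
  have h2 : pd (xi n j) (W i) 0 = -pd (xi n i) (W j) 0 := by linarith
  rw [h2] at h1
  linarith

end SolitonSystem

end Soliton

/-- on a Cahen-Wallach space with `κᵢ ≠ κⱼ` for some `i, j`, every
solution of the Ricci soliton equation `L_X g_cw + Ric = λ g_cw` has the form described
in Remark 3.3 of the paper. -/
theorem cw_soliton_general_solution {n : ℕ} (κ : Fin n → ℝ) (hκ : ∀ i, κ i ≠ 0)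
    (hne : ∃ i j, κ i ≠ κ j) (lam : ℝ)
    (X : Pt n → Fin (n + 2) → ℝ) (hX : ∀ k, ContDiff ℝ (⊤ : ℕ∞) (fun p => X p k))
    (hsol : ∀ (p : Pt n) (i j : Fin (n + 2)),
      lieCW κ X p i j + RicCW κ p i j = lam * gCW κ p i j) :
    ∃ (a b : ℝ) (c : Fin n → Fin n → ℝ) (hf : Fin n → ℝ → ℝ),
      (∀ i j, c i j = -c j i) ∧
      (∀ i j, c i j * (κ i - κ j) = 0) ∧
      (∀ i, ContDiff ℝ (⊤ : ℕ∞) (hf i)) ∧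
      (∀ i u, κ i * hf i u - deriv (deriv (hf i)) u = 0) ∧
      ∀ p : Pt n,
        X p 0 = a ∧
        X p 1 = b + lam * p.2.1 + (∑ i, κ i) * p.1 / 2
          - ∑ i, p.2.2 i * deriv (hf i) p.1 ∧
        ∀ j : Fin n, X p (xi n j) = lam / 2 * p.2.2 j + hf j p.1
          + ∑ i ∈ Finset.univ.erase j, c i j * p.2.2 i := by
  have h := solitonSystem_of_lieCW hX hsol
  obtain ⟨i₀, -⟩ := hne
  have hU := h.pd_u_U hκ i₀
  have hderiv : ∀ i, deriv (fun u => X (u, 0, 0) (xi n i))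
      = fun u => pd 0 (fun p => X p (xi n i)) (u, 0, 0) :=
    fun i => funext fun u => (h.hasDerivAt_W i u).deriv
  refine ⟨X 0 0, X 0 1, fun i j => if i = j then 0 else pd (xi n i) (fun p => X p (xi n j)) 0,
    fun i u => X (u, 0, 0) (xi n i), fun i j => ?_, fun i j => ?_, fun i => ?_, fun i u => ?_,
    fun p => ⟨?_, ?_, fun j => ?_⟩⟩
  · rcases eq_or_ne i j with rfl | hij
    · simp
    · have := h.xx i j 0
      rw [if_neg hij] at this
      simp only [if_neg hij, if_neg hij.symm]
      linarith
  · rcases eq_or_ne i j with rfl | hij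
    · simp
    · simpa only [if_neg hij] using h.pd_x_W_mul_sub hκ hij
  · exact (h.smooth_W i).comp (contDiff_id.prodMk contDiff_const)
  · rw [hderiv, (hasDerivAt_axis (contDiff_pd (h.smooth_W i) 0).differentiable_pt u).deriv,
      h.pd_u_pd_u_W hκ, sub_self]
  · refine eq_const h.smooth_U.differentiable_pt (fun k q => ?_) p
    induction k using index_cases with
    | h0 => exact hU q
    | h1 => exact h.vv q
    | hx a => exact h.pd_x_U hκ a q
  · simpa only [hderiv] using h.V_eq hκ hU p
  · have hW := h.W_eq hκ j p
    rw [← Finset.add_sum_erase _ _ (Finset.mem_univ j), h.pd_x_W_self] at hW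
    have hc : ∀ i ∈ Finset.univ.erase j,
        (if i = j then 0 else pd (xi n i) (fun p => X p (xi n j)) 0) * p.2.2 i
          = pd (xi n i) (fun p => X p (xi n j)) 0 * p.2.2 i :=
      fun i hi => by rw [if_neg (Finset.ne_of_mem_erase hi)]
    rw [hW, Finset.sum_congr rfl hc]
    ring
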